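/- There is no projective 16-divisible binary linear code of effective length 131 and dimension 9. That is, there is no 9-dimensional linear subspace C of F₂^131 such that for every coordinate i there is c ∈ C with c_i ≠ 0, for all distinct coordinates i ≠ j there is c ∈ C with c_i ≠ c_j, and 16 divides the Hamming weight of every codeword of C. -/

import Mathlib

/-- Hamming weight of a binary vector. -/
def hwt {n : ℕ} (c : Fin n → ZMod 2) : ℕ :=
  (Finset.univ.filter fun i => c i ≠ 0).card

def chi (x : ZMod 2) : ℤ := if x = 0 then 1 else -1

lemma chi_add (x y : ZMod 2) : chi (x + y) = chi x * chi y := by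
  revert x y; decide

lemma chi_sq (x : ZMod 2) : chi x * chi x = 1 := by
  revert x; decide

lemma chi_ne {x : ZMod 2} (h : x ≠ 0) : chi x = -1 := by
  simp [chi, h]

lemma add_ne_of_ne {x y : ZMod 2} (h : x ≠ y) : x + y ≠ 0 := by
  revert x y; decide

def wT (T : Finset (Fin 131)) (d : Fin 131 → ZMod 2) : ℤ :=
  ∑ i ∈ T, if d i = 0 then 0 else 1

lemma wT_univ (d : Fin 131 → ZMod 2) : wT Finset.univ d = (hwt d : ℤ) := by
  unfold wT hwt
  rw [Finset.card_filter]
  push_cast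
  refine Finset.sum_congr rfl fun i _ => ?_
  by_cases h : d i = 0 <;> simp [h]

lemma wT_chi (T : Finset (Fin 131)) (d : Fin 131 → ZMod 2) :
    2 * wT T d = (T.card : ℤ) - ∑ i ∈ T, chi (d i) := by
  unfold wT
  rw [Finset.card_eq_sum_ones]
  push_cast
  rw [Finset.mul_sum, ← Finset.sum_sub_distrib]
  refine Finset.sum_congr rfl fun i _ => ?_
  by_cases h : d i = 0 <;> simp [h, chi]

section
variable (C : Submodule (ZMod 2) (Fin 131 → ZMod 2)) [Fintype C]

lemma sum_chi_one (i : Fin 131) (h : ∃ c ∈ C, c i ≠ 0) :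
    ∑ d : C, chi (d.1 i) = 0 := by
  obtain ⟨c, hc, hci⟩ := h
  have := Equiv.sum_comp (Equiv.addRight (⟨c, hc⟩ : C)) (fun d : C => chi (d.1 i))
  simp only [Equiv.coe_addRight, Submodule.coe_add, Pi.add_apply, chi_add, chi_ne hci] at this
  rw [← Finset.sum_mul] at this
  linarith

lemma sum_chi_two (i j : Fin 131) (h : ∃ c ∈ C, c i ≠ c j) :
    ∑ d : C, chi (d.1 i) * chi (d.1 j) = 0 := by
  obtain ⟨c, hc, hci⟩ := h
  have := Equiv.sum_comp (Equiv.addRight (⟨c, hc⟩ : C))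
    (fun d : C => chi (d.1 i + d.1 j))
  have h2 : ∀ d : C, chi (d.1 i + c i + (d.1 j + c j)) = chi (d.1 i + d.1 j) * (-1) := by
    intro d
    rw [← chi_ne (add_ne_of_ne hci), ← chi_add]
    congr 1; ring
  simp only [Equiv.coe_addRight, Submodule.coe_add, Pi.add_apply, h2] at this
  rw [← Finset.sum_mul] at this
  simp only [← chi_add]
  linarith

lemma quad (hcard : Fintype.card C = 512)
    (h1 : ∀ i : Fin 131, ∃ c ∈ C, c i ≠ 0)
    (h2 : ∀ i j : Fin 131, i ≠ j → ∃ c ∈ C, c i ≠ c j) (T : Finset (Fin 131)) (t : ℤ)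
    (ht : (T.card : ℤ) = t) :
    ∑ d : C, wT T d.1 = 256 * t ∧
    ∀ a b : ℤ, ∑ d : C, (wT T d.1 - a) * (wT T d.1 - b)
      = 128 * t * (t + 1) - (a + b) * (256 * t) + 512 * (a * b) := by
  have s1 : ∑ d : C, ∑ i ∈ T, chi (d.1 i) = 0 := by
    rw [Finset.sum_comm]
    exact Finset.sum_eq_zero fun i _ => sum_chi_one C i (h1 i)
  have s2 : ∑ d : C, (∑ i ∈ T, chi (d.1 i)) * (∑ i ∈ T, chi (d.1 i)) = 512 * t := by
    simp only [Finset.sum_mul_sum]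
    rw [Finset.sum_comm]
    have : ∀ i ∈ T, ∑ d : C, ∑ j ∈ T, chi (d.1 i) * chi (d.1 j) = 512 := by
      intro i hi
      rw [Finset.sum_comm, Finset.sum_eq_single_of_mem i hi]
      · simp [chi_sq, hcard]
      · intro j _ hj
        exact sum_chi_two C i j (h2 i j hj.symm)
    rw [Finset.sum_congr rfl this]
    simp [ht, mul_comm]
  have c1 : ∑ d : C, (1 : ℤ) = 512 := by simp [hcard]
  have e : ∀ d : C, ∑ i ∈ T, chi (d.1 i) = t - 2 * wT T d.1 := by
    intro d; have := wT_chi T d.1; rw [ht] at this; linarith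
  simp only [e] at s1 s2
  have s1' : t * 512 - 2 * ∑ d : C, wT T d.1 = 0 := by
    rw [← s1, ← c1, Finset.mul_sum, Finset.mul_sum, ← Finset.sum_sub_distrib]
    simp
  have s2' : t * t * 512 - 4 * t * ∑ d : C, wT T d.1 + 4 * ∑ d : C, wT T d.1 * wT T d.1
      = 512 * t := by
    rw [← s2, ← c1, Finset.mul_sum, Finset.mul_sum, Finset.mul_sum, ← Finset.sum_sub_distrib,
      ← Finset.sum_add_distrib]
    refine Finset.sum_congr rfl fun d _ => ?_
    ring
  have f1 : ∑ d : C, wT T d.1 = 256 * t := by linarith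
  refine ⟨f1, fun a b => ?_⟩
  have : ∑ d : C, (wT T d.1 - a) * (wT T d.1 - b) =
      ∑ d : C, wT T d.1 * wT T d.1 - (a + b) * ∑ d : C, wT T d.1 + a * b * ∑ d : C, (1 : ℤ) := by
    rw [Finset.mul_sum, Finset.mul_sum, ← Finset.sum_sub_distrib, ← Finset.sum_add_distrib]
    refine Finset.sum_congr rfl fun d _ => ?_
    ring
  rw [this, c1, f1]
  rw [f1] at s2'
  linarith

end

def zs (c : Fin 131 → ZMod 2) : Finset (Fin 131) := Finset.univ.filter fun i => c i = 0

lemma zs_card (c : Fin 131 → ZMod 2) : ((zs c).card : ℤ) = 131 - wT Finset.univ c := by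
  have := Finset.card_filter_add_card_filter_not (s := (Finset.univ : Finset (Fin 131)))
    (fun i => c i = 0)
  rw [wT_univ]
  unfold zs hwt
  simp only [Finset.card_univ, Fintype.card_fin] at this
  simp only [ne_eq]
  omega

lemma zs_wt (c d : Fin 131 → ZMod 2) :
    2 * wT (zs c) d = wT Finset.univ d + wT Finset.univ (d + c) - wT Finset.univ c := by
  unfold wT zs
  rw [Finset.sum_filter, Finset.mul_sum, ← Finset.sum_add_distrib, ← Finset.sum_sub_distrib]
  refine Finset.sum_congr rfl fun i _ => ?_
  simp only [Pi.add_apply]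
  have H : ∀ x y : ZMod 2, (2 * if x = 0 then if y = 0 then (0 : ℤ) else 1 else 0) =
      ((if y = 0 then 0 else 1) + if y + x = 0 then 0 else 1) - if x = 0 then 0 else 1 := by
    decide
  convert H (c i) (d i)

lemma quad_nonneg (m k : ℤ) : 0 ≤ (m - k) * (m - (k + 1)) := by
  rcases le_or_gt m k with h | h
  · nlinarith
  · have : k + 1 ≤ m := h
    nlinarith

/-- There is no projective 16-divisible binary linear code of effective length 131
and dimension 9. -/
theorem no_projective_16_divisible_131_dim_9 :
    ¬ ∃ C : Submodule (ZMod 2) (Fin 131 → ZMod 2),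
      Module.finrank (ZMod 2) C = 9 ∧
      (∀ i : Fin 131, ∃ c ∈ C, c i ≠ 0) ∧
      (∀ i j : Fin 131, i ≠ j → ∃ c ∈ C, c i ≠ c j) ∧
      (∀ c ∈ C, 16 ∣ hwt c) := by
  classical
  rintro ⟨C, hk, h1, h2, hdiv⟩
  have : Fintype C := Fintype.ofFinite C
  have hcard : Fintype.card C = 512 := by
    rw [Module.card_eq_pow_finrank (K := ZMod 2), hk, ZMod.card]; norm_num
  have Q := quad C hcard h1 h2
  obtain ⟨w, hw⟩ : ∃ w : C → ℤ, ∀ d, w d = wT Finset.univ d.1 := ⟨_, fun _ => rfl⟩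
  have hm : ∀ d : C, ∃ m : ℤ, w d = 16 * m := by
    intro d
    obtain ⟨m, hm⟩ := hdiv d.1 d.2
    exact ⟨m, by rw [hw, wT_univ, hm]; push_cast; ring⟩
  have w0 : w 0 = 0 := by rw [hw]; simp [wT]
  have self : ∀ d : C, d + d = 0 := by
    intro d
    ext i
    exact CharTwo.add_self_eq_zero _
  obtain ⟨Qs, Qq⟩ := Q Finset.univ 131 (by simp)
  simp only [← hw] at Qs Qq
  have q1 := Qq 64 80
  norm_num at q1 Qs
  have nn : ∀ d : C, 0 ≤ (w d - 64) * (w d - 80) := by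
    intro d
    obtain ⟨m, hm⟩ := hm d
    have := quad_nonneg m 4
    rw [hm]; nlinarith
  -- residual quantities
  have R : ∀ c : C, ∃ f : C → ℤ, (∀ d, 2 * f d = w d + w (d + c) - w c) ∧
      (∀ d, ∃ m, f d = 8 * m) ∧
      ∀ a b : ℤ, ∑ d : C, (f d - a) * (f d - b)
      = 128 * (131 - w c) * ((131 - w c) + 1) - (a + b) * (256 * (131 - w c)) + 512 * (a * b) := by
    intro c
    have hf : ∀ d : C, 2 * wT (zs c.1) d.1 = w d + w (d + c) - w c := by
      intro d; simp only [hw]; exact zs_wt c.1 d.1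
    refine ⟨fun d => wT (zs c.1) d.1, hf, ?_, (Q (zs c.1) _ (by rw [zs_card, ← hw])).2⟩
    intro d
    obtain ⟨m1, e1⟩ := hm d
    obtain ⟨m2, e2⟩ := hm (d + c)
    obtain ⟨m3, e3⟩ := hm c
    refine ⟨m1 + m2 - m3, ?_⟩
    have := hf d
    dsimp only
    linarith
  have no96 : ∀ c : C, w c ≠ 96 := by
    intro c hc
    obtain ⟨f, -, f2, f3⟩ := R c
    have := f3 16 24
    rw [hc] at this
    norm_num at this
    have : 0 ≤ ∑ d : C, (f d - 16) * (f d - 24) := by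
      refine Finset.sum_nonneg fun d _ => ?_
      obtain ⟨m, hm⟩ := f2 d
      have := quad_nonneg m 2
      rw [hm]; nlinarith
    linarith
  have vals : ∀ c : C, c ≠ 0 → w c = 48 ∨ w c = 64 ∨ w c = 80 := by
    intro c hc
    have := Finset.sum_le_sum_of_subset_of_nonneg (Finset.subset_univ ({0, c} : Finset C))
      (fun d _ _ => nn d)
    rw [Finset.sum_pair hc.symm, q1, w0] at this
    obtain ⟨m, hm⟩ := hm c
    have h96 := no96 c
    rw [hm] at this h96 ⊢
    have a1 : 3 ≤ m := by nlinarith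
    have a2 : m ≤ 6 := by nlinarith
    interval_cases m <;> simp_all
  have uniq : ∀ c d : C, w c = 48 → w d = 48 → c = d := by
    intro c d hc hd
    by_contra hne
    have c0 : (0 : C) ≠ c := by rintro rfl; omega
    have d0 : (0 : C) ≠ d := by rintro rfl; omega
    have := Finset.sum_le_sum_of_subset_of_nonneg (Finset.subset_univ ({0, c, d} : Finset C))
      (fun d _ _ => nn d)
    rw [Finset.sum_insert (by simp [c0, d0]), Finset.sum_pair hne, q1, w0, hc, hd] at this
    norm_num at this
  have ex : ∃ c : C, w c = 48 := by
    by_contra hno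
    push Not at hno
    rw [Finset.sum_eq_single_of_mem (0 : C) (Finset.mem_univ _), w0] at q1
    · norm_num at q1
    · intro d _ hd
      rcases vals d hd with h | h | h
      · exact absurd h (hno d)
      · rw [h]; norm_num
      · rw [h]; norm_num
  obtain ⟨e, he⟩ := ex
  have e0 : e ≠ 0 := by rintro rfl; omega
  -- number of words of weight 80
  have cnt : ((Finset.univ.filter fun d : C => w d = 80).card : ℤ) = 53 := by
    have p : ∀ d : C, w d = 64 + (16 * (if w d = 80 then 1 else 0) - (if d = 0 then 64 else 0)
        - (if d = e then 16 else 0)) := by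
      intro d
      by_cases hd : d = 0
      · subst hd; simp [w0, e0.symm]
      by_cases hde : d = e
      · subst hde; simp [he, e0]
      rcases vals d hd with h | h | h
      · exact absurd (uniq d e h he) hde
      · simp [h, hd, hde]
      · simp [h, hd, hde]
    rw [Finset.sum_congr rfl (fun d _ => p d)] at Qs
    rw [Finset.sum_add_distrib, Finset.sum_sub_distrib, Finset.sum_sub_distrib, ← Finset.mul_sum,
      Finset.sum_ite_eq' , Finset.sum_ite_eq', Finset.sum_const, Finset.card_univ, hcard,
      ← Finset.natCast_card_filter] at Qs
    simp only [Finset.mem_univ, if_true, nsmul_eq_mul] at Qs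
    push_cast at Qs
    linarith
  have key : ∀ c : C, w c = 80 → w (c + e) = 80 := by
    intro c hc
    have ce : c ≠ e := by rintro rfl; omega
    have c0 : c ≠ 0 := by rintro rfl; omega
    have s0 : c + e ≠ 0 := by
      intro h
      apply ce
      have := self e
      rw [← this] at h
      exact add_right_cancel h
    rcases vals _ s0 with h | h | h
    · exact absurd (by simpa using uniq _ _ h he) c0
    · exfalso
      obtain ⟨f, f1, f2, f3⟩ := R c
      have q := f3 24 32
      rw [hc] at q
      norm_num at q
      have nn : ∀ d : C, 0 ≤ (f d - 24) * (f d - 32) := by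
        intro d
        obtain ⟨m, hm⟩ := f2 d
        have := quad_nonneg m 3
        rw [hm]; nlinarith
      have v0 : f 0 = 0 := by have := f1 0; rw [zero_add, w0] at this; linarith
      have vc : f c = 0 := by have := f1 c; rw [self, w0] at this; linarith
      have ve : f e = 16 := by have := f1 e; rw [add_comm e c, h, he, hc] at this; linarith
      have := Finset.sum_le_sum_of_subset_of_nonneg (Finset.subset_univ ({0, c, e} : Finset C))
        (fun d _ _ => nn d)
      rw [Finset.sum_insert (by simp [c0.symm, e0.symm]), Finset.sum_pair ce, q, v0, vc, ve]
        at this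
      norm_num at this
    · exact h
  have inv : ∑ d ∈ Finset.univ.filter (fun d : C => w d = 80), (1 : ZMod 2) = 0 := by
    refine Finset.sum_involution (fun d _ => d + e) ?_ ?_ ?_ ?_
    · intro d _; decide
    · intro d _ _ h; exact e0 (by simpa using h)
    · intro d hd
      simp only [Finset.mem_filter, Finset.mem_univ, true_and] at hd ⊢
      exact key d hd
    · intro d _
      rw [add_assoc, self, add_zero]
  have c53 : (Finset.univ.filter fun d : C => w d = 80).card = 53 := by exact_mod_cast cnt
  rw [Finset.sum_const, c53] at inv
  revert inv
  decide
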